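/- Let G be a commutative monoid, p, b ∈ G, let (A g)_{g ∈ G} be a dimensioned Poisson algebra of dimensions (p, b), and let I be a dimensioned coisotrope of A. Define the dimensioned Lie idealizer N(I) by N(I) g := {n ∈ A g | ∀ h, ∀ i ∈ I h, {n, i} ∈ I (b*g*h)}. Then: (i) I g ⊆ N(I) g for every g ∈ G; (ii) N(I) is a dimensioned Lie subalgebra, i.e. {n, m} ∈ N(I) (b*g*h) for all n ∈ N(I) g, m ∈ N(I) h, and I is a dimensioned Lie ideal of N(I); and (iii) by the Leibniz identity, N(I) is closed under the commutative multiplication, i.e. n * m ∈ N(I) (p*g*h) for all n ∈ N(I) g, m ∈ N(I) h, and I is a multiplicative ideal of N(I). -/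

import Mathlib

universe u v

/-- Canonical transport of elements of a type family along an equality of indices. -/
def dcast {G : Type u} (A : G → Type v) {g h : G} (e : g = h) : A g → A h :=
  fun a => cast (congrArg A e) a

section Dims
variable {G : Type u} [CommMonoid G]

theorem dim_massoc (p g h k : G) : p * (p * g * h) * k = p * g * (p * h * k) := by ac_rfl
theorem dim_mcomm (p g h : G) : p * g * h = p * h * g := by ac_rfl
theorem dim_jac (b g h k : G) : b * h * (b * g * k) = b * g * (b * h * k) := by ac_rfl
theorem dim_leib₁ (p b g h k : G) : p * (b * g * h) * k = b * g * (p * h * k) := by ac_rfl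
theorem dim_leib₂ (p b g h k : G) : p * h * (b * g * k) = b * g * (p * h * k) := by ac_rfl

end Dims

/-- A dimensioned Poisson algebra of dimensions `(p, b)` over a commutative monoid `G`:
a family of additive commutative groups `A g` equipped with biadditive commutative
associative multiplication maps `* : A g → A h → A (p * g * h)` and biadditive
antisymmetric Jacobi bracket maps `{,} : A g → A h → A (b * g * h)` interacting via the
Leibniz identity, index equalities being handled by canonical transport. -/
structure DimPoissonOn {G : Type u} [CommMonoid G] (p b : G) (A : G → Type v)
    [∀ g, AddCommGroup (A g)] where
  mul : ∀ {g h : G}, A g → A h → A (p * g * h)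
  bracket : ∀ {g h : G}, A g → A h → A (b * g * h)
  mul_add : ∀ {g h : G} (x : A g) (y z : A h), mul x (y + z) = mul x y + mul x z
  add_mul : ∀ {g h : G} (x y : A g) (z : A h), mul (x + y) z = mul x z + mul y z
  bracket_add : ∀ {g h : G} (x : A g) (y z : A h),
    bracket x (y + z) = bracket x y + bracket x z
  add_bracket : ∀ {g h : G} (x y : A g) (z : A h),
    bracket (x + y) z = bracket x z + bracket y z
  mul_assoc' : ∀ {g h k : G} (x : A g) (y : A h) (z : A k),
    dcast A (dim_massoc p g h k) (mul (mul x y) z) = mul x (mul y z)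
  mul_comm' : ∀ {g h : G} (x : A g) (y : A h),
    dcast A (dim_mcomm p g h) (mul x y) = mul y x
  bracket_antisymm : ∀ {g h : G} (x : A g) (y : A h),
    dcast A (dim_mcomm b g h) (bracket x y) = - bracket y x
  jacobi : ∀ {g h k : G} (x : A g) (y : A h) (z : A k),
    bracket x (bracket y z)
      = dcast A (dim_massoc b g h k) (bracket (bracket x y) z)
        + dcast A (dim_jac b g h k) (bracket y (bracket x z))
  leibniz : ∀ {g h k : G} (x : A g) (y : A h) (z : A k),
    bracket x (mul y z)
      = dcast A (dim_leib₁ p b g h k) (mul (bracket x y) z)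
        + dcast A (dim_leib₂ p b g h k) (mul y (bracket x z))

/-- The dimensioned Lie idealizer `N(I)` of a family of additive subgroups `I` in a
dimensioned Poisson algebra: `N(I) g = {n ∈ A g | ∀ h, ∀ i ∈ I h, {n, i} ∈ I (b * g * h)}`. -/
def lieIdealizer {G : Type u} [CommMonoid G] {p b : G} {A : G → Type v}
    [∀ g, AddCommGroup (A g)] (P : DimPoissonOn p b A) (I : ∀ g, AddSubgroup (A g))
    (g : G) : Set (A g) :=
  {n : A g | ∀ (h : G), ∀ i ∈ I h, P.bracket n i ∈ I (b * g * h)}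

theorem dcast_mem_iff {G : Type u} {A : G → Type v} [∀ g, AddCommGroup (A g)]
    (I : ∀ g, AddSubgroup (A g)) {g h : G} (e : g = h) (x : A g) :
    dcast A e x ∈ I h ↔ x ∈ I g := by
  subst e
  rfl

section DimPoissonOn

variable {G : Type u} [CommMonoid G] {p b : G} {A : G → Type v} [∀ g, AddCommGroup (A g)]
  (P : DimPoissonOn p b A) (I : ∀ g, AddSubgroup (A g))

theorem bracket_mem_comm {g h : G} (x : A g) (y : A h) :
    P.bracket x y ∈ I (b * g * h) ↔ P.bracket y x ∈ I (b * h * g) := by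
  rw [← dcast_mem_iff I (dim_mcomm b g h), P.bracket_antisymm, neg_mem_iff]

theorem mul_mem_comm {g h : G} (x : A g) (y : A h) :
    P.mul x y ∈ I (p * g * h) ↔ P.mul y x ∈ I (p * h * g) := by
  rw [← dcast_mem_iff I (dim_mcomm p g h), P.mul_comm']

end DimPoissonOn

/-- For a dimensioned coisotrope `I` in a dimensioned Poisson algebra `A`
of dimensions `(p, b)` over a commutative monoid `G`, the dimensioned Lie idealizer `N(I)`
satisfies: (i) `I g ⊆ N(I) g`; (ii) `N(I)` is a dimensioned Lie subalgebra and `I` is a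
dimensioned Lie ideal of `N(I)`; (iii) by the Leibniz identity `N(I)` is closed under the
commutative multiplication and `I` is a multiplicative ideal of `N(I)`. -/
theorem lie_idealizer_subalgebra {G : Type u} [CommMonoid G] (p b : G) (A : G → Type v)
    [∀ g, AddCommGroup (A g)] (P : DimPoissonOn p b A)
    (I : ∀ g, AddSubgroup (A g))
    (hImul : ∀ {g h : G} (x : A g) (i : A h), i ∈ I h → P.mul x i ∈ I (p * g * h))
    (hIbr : ∀ {g h : G} (i : A g) (j : A h), i ∈ I g → j ∈ I h → P.bracket i j ∈ I (b * g * h)) :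
    -- (i) `I ⊆ N(I)`:
    (∀ g : G, (I g : Set (A g)) ⊆ lieIdealizer P I g) ∧
    -- (ii) `N(I)` is a dimensioned Lie subalgebra ...
    (∀ {g h : G} (n : A g) (m : A h),
      n ∈ lieIdealizer P I g → m ∈ lieIdealizer P I h →
        P.bracket n m ∈ lieIdealizer P I (b * g * h)) ∧
    -- ... containing `I` as a dimensioned Lie ideal:
    (∀ {g h : G} (n : A g) (i : A h),
      n ∈ lieIdealizer P I g → i ∈ I h → P.bracket n i ∈ I (b * g * h)) ∧
    (∀ {g h : G} (i : A g) (n : A h),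
      i ∈ I g → n ∈ lieIdealizer P I h → P.bracket i n ∈ I (b * g * h)) ∧
    -- (iii) `N(I)` is closed under the commutative multiplication ...
    (∀ {g h : G} (n : A g) (m : A h),
      n ∈ lieIdealizer P I g → m ∈ lieIdealizer P I h →
        P.mul n m ∈ lieIdealizer P I (p * g * h)) ∧
    -- ... and `I` is a multiplicative ideal of `N(I)`:
    (∀ {g h : G} (n : A g) (i : A h),
      n ∈ lieIdealizer P I g → i ∈ I h → P.mul n i ∈ I (p * g * h)) := by
  have hswap : ∀ {g h : G} (i : A g) (n : A h),
      i ∈ I g → n ∈ lieIdealizer P I h → P.bracket i n ∈ I (b * g * h) := fun i n hi hn =>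
    (bracket_mem_comm P I n i).1 (hn _ i hi)
  refine ⟨fun g i hi h j hj => hIbr i j hi hj, ?_, fun n i hn hi => hn _ i hi, hswap, ?_,
    fun n i _ hi => hImul n i hi⟩
  · intro g h n m hn hm k i hi
    have hnmi := hn _ _ (hm _ i hi)
    have hmni := hm _ _ (hn _ i hi)
    rw [P.jacobi] at hnmi
    exact (dcast_mem_iff I _ _).1
      (((I _).add_mem_cancel_right ((dcast_mem_iff I _ _).2 hmni)).1 hnmi)
  · intro g h n m hn hm k i hi
    rw [bracket_mem_comm, P.leibniz]
    refine (I _).add_mem ((dcast_mem_iff I _ _).2 ?_) ((dcast_mem_iff I _ _).2 ?_)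
    · rw [mul_mem_comm]
      exact hImul m _ (hswap i n hi hn)
    · exact hImul n _ (hswap i m hi hm)
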